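/- arXiv:2501.12576 — 6 statements merged into one kernel-verified Lean document; each statement's English description precedes it below -/
import Mathlib

section
/- Let K, N, s be natural numbers, R : Fin K → ℝ antitone (buying utilities sorted in nonincreasing order) and C : Fin N → ℝ monotone (selling costs sorted in nondecreasing order). Then for all injective maps ι : Fin s → Fin K and σ : Fin s → Fin N, ∑_{i : Fin s} (R(ι i) − C(σ i)) ≤ ∑_{i=0}^{s−1} (R(i) − C(i)). In words: among all ways to match s distinct buyers to s distinct sellers, the total surplus never exceeds that of pairing the s highest-utility buyers with the s lowest-cost sellers. -/
theorem Fin.castLE_le_of_strictMono {s n : ℕ} (h : s ≤ n) {f : Fin s → Fin n}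
    (hf : StrictMono f) (i : Fin s) : Fin.castLE h i ≤ f i := by
  obtain ⟨i, hi⟩ := i
  induction i with
  | zero => exact Nat.zero_le _
  | succ k ih =>
    have hlt : f ⟨k, by omega⟩ < f ⟨k + 1, hi⟩ := hf (Fin.mk_lt_mk.2 k.lt_succ_self)
    exact Nat.succ_le_of_lt (lt_of_le_of_lt (ih (by omega)) hlt)

/-- The sum of the first `s` values of a monotone sequence is at most the sum of its values at
any `s` distinct indices. -/
theorem Monotone.sum_castLE_le_sum_comp_injective {M : Type*} [AddCommMonoid M] [PartialOrder M]
    [IsOrderedAddMonoid M] {s n : ℕ} (h : s ≤ n) {f : Fin n → M} (hf : Monotone f)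
    {σ : Fin s → Fin n} (hσ : Function.Injective σ) :
    ∑ i, f (Fin.castLE h i) ≤ ∑ i, f (σ i) := by
  have hmono : StrictMono (σ ∘ Tuple.sort σ) :=
    (Tuple.monotone_sort σ).strictMono_of_injective (hσ.comp (Tuple.sort σ).injective)
  rw [← Equiv.sum_comp (Tuple.sort σ) fun i => f (σ i)]
  exact Finset.sum_le_sum fun i _ => hf (Fin.castLE_le_of_strictMono h hmono i)

/-- Among all ways to match `s` distinct buyers to `s` distinct sellers, the total
surplus never exceeds that of pairing the `s` highest-utility buyers with the
`s` lowest-cost sellers. -/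
theorem matching_surplus_le_aligned
    (K N s : ℕ) (hsK : s ≤ K) (hsN : s ≤ N)
    (R : Fin K → ℝ) (C : Fin N → ℝ)
    (hR : Antitone R) (hC : Monotone C)
    (ι : Fin s → Fin K) (σ : Fin s → Fin N)
    (hι : Function.Injective ι) (hσ : Function.Injective σ) :
    ∑ i : Fin s, (R (ι i) - C (σ i)) ≤
      ∑ i : Fin s, (R (Fin.castLE hsK i) - C (Fin.castLE hsN i)) := by
  have hbuy := hR.neg.sum_castLE_le_sum_comp_injective hsK hι
  have hsell := hC.sum_castLE_le_sum_comp_injective hsN hσ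
  simp only [Finset.sum_neg_distrib, neg_le_neg_iff] at hbuy
  simp only [Finset.sum_sub_distrib]
  exact sub_le_sub hbuy hsell
end

section
/- Let K, N be positive integers, R : Fin K → ℝ antitone and C : Fin N → ℝ monotone, and let j ≤ min(K, N) be a threshold index such that R(i) ≥ C(i) for all i < j, and either j = min(K, N) or R(j) < C(j). Then: (a) for every s ≤ min(K, N) and all injections ι : Fin s → Fin K, σ : Fin s → Fin N, the surplus satisfies ∑_{i : Fin s} (R(ι i) − C(σ i)) ≤ ∑_{i=0}^{j−1} (R(i) − C(i)); (b) the aligned matching of size j given by ι(i) = σ(i) = i attains this bound and satisfies R(ι i) ≥ C(σ i) for every matched pair. Hence the maximum surplus over all partial matchings equals ∑_{i=0}^{j−1} (R(i) − C(i)), and it is attained by a matching respecting the feasibility constraint. -/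
theorem Fin.val_le_val_apply_of_strictMono {s n : ℕ} {f : Fin s → Fin n} (hf : StrictMono f)
    (i : Fin s) : (i : ℕ) ≤ f i := by
  obtain ⟨i, hi⟩ := i
  induction i with
  | zero => exact Nat.zero_le _
  | succ k ih =>
    have h : f ⟨k, by omega⟩ < f ⟨k + 1, hi⟩ := hf (Fin.mk_lt_mk.2 k.lt_succ_self)
    have := ih (by omega)
    simp only [Fin.lt_def] at h this ⊢
    omega

/-- Among all injective selections of `s` values of an antitone function, the initial one has the
largest sum. -/
theorem Antitone.sum_comp_injective_le_sum_castLE {n s : ℕ} {f : Fin n → ℝ} (hf : Antitone f)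
    (hs : s ≤ n) {g : Fin s → Fin n} (hg : Function.Injective g) :
    ∑ i, f (g i) ≤ ∑ i : Fin s, f (Fin.castLE hs i) := by
  set S : Finset (Fin n) := Finset.univ.map ⟨g, hg⟩ with hS
  have hcard : S.card = s := by simp [hS]
  calc ∑ i, f (g i) = ∑ x ∈ S, f x := by simp [hS]
    _ = ∑ i, f (S.orderEmbOfFin hcard i) := by
      conv_lhs => rw [← Finset.map_orderEmbOfFin_univ S hcard, Finset.sum_map]
      rfl
    _ ≤ ∑ i : Fin s, f (Fin.castLE hs i) := Finset.sum_le_sum fun i _ =>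
      hf (Fin.val_le_val_apply_of_strictMono (S.orderEmbOfFin hcard).strictMono i)

/-- Partial sums of a sequence are largest at the index where its terms change sign. -/
theorem Finset.sum_range_le_sum_range_of_sign_change {g : ℕ → ℝ} {j s : ℕ}
    (hpos : ∀ i < j, 0 ≤ g i) (hneg : ∀ i, j ≤ i → i < s → g i ≤ 0) :
    ∑ i ∈ Finset.range s, g i ≤ ∑ i ∈ Finset.range j, g i := by
  rcases le_total s j with h | h
  · exact Finset.sum_le_sum_of_subset_of_nonneg (Finset.range_mono h)
      fun i hi _ => hpos i (Finset.mem_range.1 hi)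
  · rw [← Finset.sum_range_add_sum_Ico g h]
    have : ∑ i ∈ Finset.Ico j s, g i ≤ 0 := Finset.sum_nonpos fun i hi =>
      hneg i (Finset.mem_Ico.1 hi).1 (Finset.mem_Ico.1 hi).2
    linarith

/-- With a threshold index `j` (the paper's `A_th`) such that `R i ≥ C i` for `i < j`
and either `j = min K N` or `R j < C j`:
(a) every partial matching of any size `s ≤ min K N` has surplus at most
`∑_{i<j} (R i − C i)`, and
(b) the aligned matching of size `j` (via the canonical embeddings) is injective,
attains this bound, and is feasible (`R (ι i) ≥ C (σ i)` for every matched pair). -/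
theorem threshold_matching_optimal
    (K N j : ℕ) (hK : 0 < K) (hN : 0 < N)
    (R : Fin K → ℝ) (C : Fin N → ℝ)
    (hR : Antitone R) (hC : Monotone C)
    (hj : j ≤ min K N)
    (hfeas : ∀ i : Fin j,
      C (Fin.castLE (hj.trans (min_le_right K N)) i) ≤
        R (Fin.castLE (hj.trans (min_le_left K N)) i))
    (hedge : j = min K N ∨
      ∀ (h1 : j < K) (h2 : j < N), R ⟨j, h1⟩ < C ⟨j, h2⟩) :
    (∀ (s : ℕ), s ≤ min K N →
      ∀ (ι : Fin s → Fin K) (σ : Fin s → Fin N),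
        Function.Injective ι → Function.Injective σ →
          ∑ i : Fin s, (R (ι i) - C (σ i)) ≤
            ∑ i : Fin j, (R (Fin.castLE (hj.trans (min_le_left K N)) i)
              - C (Fin.castLE (hj.trans (min_le_right K N)) i)))
    ∧ Function.Injective (Fin.castLE (hj.trans (min_le_left K N)) : Fin j → Fin K)
    ∧ Function.Injective (Fin.castLE (hj.trans (min_le_right K N)) : Fin j → Fin N)
    ∧ (∀ i : Fin j,
        C (Fin.castLE (hj.trans (min_le_right K N)) i) ≤
          R (Fin.castLE (hj.trans (min_le_left K N)) i)) := by
  refine ⟨fun s hs ι σ hι hσ => ?_, Fin.castLE_injective _, Fin.castLE_injective _, hfeas⟩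
  have hsK : s ≤ K := hs.trans (min_le_left K N)
  have hsN : s ≤ N := hs.trans (min_le_right K N)
  have hbuy := hR.sum_comp_injective_le_sum_castLE hsK hι
  have hsell := hC.neg.sum_comp_injective_le_sum_castLE hsN hσ
  simp only [Finset.sum_neg_distrib] at hsell
  let g : ℕ → ℝ := fun i => if h : i < K ∧ i < N then R ⟨i, h.1⟩ - C ⟨i, h.2⟩ else 0
  have hg : ∀ {m : ℕ} (hmK : m ≤ K) (hmN : m ≤ N),
      ∑ i : Fin m, (R (Fin.castLE hmK i) - C (Fin.castLE hmN i)) =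
        ∑ i ∈ Finset.range m, g i := by
    intro m hmK hmN
    rw [Finset.sum_range]
    refine Finset.sum_congr rfl fun i _ => ?_
    have h : (i : ℕ) < K ∧ (i : ℕ) < N := ⟨i.2.trans_le hmK, i.2.trans_le hmN⟩
    simp only [g, dif_pos h]
    rfl
  have hthreshold : ∑ i ∈ Finset.range s, g i ≤ ∑ i ∈ Finset.range j, g i := by
    refine Finset.sum_range_le_sum_range_of_sign_change (fun i hi => ?_) fun i hji his => ?_
    · have h : i < K ∧ i < N := by omega
      simp only [g, dif_pos h]
      exact sub_nonneg.2 (hfeas ⟨i, hi⟩)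
    · have h : i < K ∧ i < N := by omega
      have hj' : R ⟨j, by omega⟩ < C ⟨j, by omega⟩ :=
        hedge.resolve_left (by omega) (by omega) (by omega)
      have hRi : R ⟨i, h.1⟩ ≤ R ⟨j, by omega⟩ := hR (Fin.mk_le_mk.2 hji)
      have hCi : C ⟨j, by omega⟩ ≤ C ⟨i, h.2⟩ := hC (Fin.mk_le_mk.2 hji)
      simp only [g, dif_pos h]
      linarith
  calc ∑ i, (R (ι i) - C (σ i))
      ≤ ∑ i : Fin s, (R (Fin.castLE hsK i) - C (Fin.castLE hsN i)) := by
        simp only [Finset.sum_sub_distrib]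
        linarith
    _ = ∑ i ∈ Finset.range s, g i := hg hsK hsN
    _ ≤ ∑ i ∈ Finset.range j, g i := hthreshold
    _ = _ := (hg _ _).symm
end

section
/- Let K, N be positive integers, R : Fin K → ℝ antitone, C : Fin N → ℝ monotone, and let j ≤ min(K, N) satisfy R(i) ≥ C(i) for all i < j and either j = min(K, N) or R(j) < C(j). Let b : Fin K → ℝ and q : Fin N → ℝ be trading quantities with 0 < b(k) ≤ b̄ and 0 < q(n) ≤ b̄ for all k, n. Then for every s ≤ min(K, N) and all injections ι : Fin s → Fin K, σ : Fin s → Fin N satisfying the feasibility constraint R(ι i) ≥ C(σ i) for each i, the quantity-weighted surplus satisfies ∑_{i : Fin s} min(b(ι i), q(σ i)) · (R(ι i) − C(σ i)) ≤ b̄ · ∑_{i=0}^{j−1} (R(i) − C(i)). -/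
/-- If `f` is nonnegative on the first `j` indices and nonpositive on the others, then the sum of
`f` along any injection is at most the sum over the first `j` indices. -/
theorem Fin.sum_comp_injective_le_sum_castLE {s j K : ℕ} (h : j ≤ K) {f : Fin K → ℝ}
    (hpos : ∀ k : Fin K, (k : ℕ) < j → 0 ≤ f k) (hneg : ∀ k : Fin K, j ≤ (k : ℕ) → f k ≤ 0)
    {ι : Fin s → Fin K} (hι : Function.Injective ι) :
    ∑ i, f (ι i) ≤ ∑ i : Fin j, f (Fin.castLE h i) :=
  calc ∑ i, f (ι i) ≤ ∑ i, max (f (ι i)) 0 := Finset.sum_le_sum fun _ _ ↦ le_max_left _ _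
    _ = ∑ k ∈ Finset.univ.map ⟨ι, hι⟩, max (f k) 0 := by simp
    _ ≤ ∑ k, max (f k) 0 :=
      Finset.sum_le_sum_of_subset_of_nonneg (Finset.subset_univ _) fun _ _ _ ↦ le_max_right _ _
    _ = ∑ k ∈ Finset.univ.map (Fin.castLEEmb h), max (f k) 0 := by
      refine (Finset.sum_subset (Finset.subset_univ _) fun k _ hk ↦ max_eq_right (hneg k ?_)).symm
      by_contra! hlt
      exact hk (Finset.mem_map.2 ⟨⟨k, hlt⟩, Finset.mem_univ _, rfl⟩)
    _ = ∑ i : Fin j, f (Fin.castLE h i) := by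
      rw [Finset.sum_map]
      exact Finset.sum_congr rfl fun i _ ↦ max_eq_left (hpos _ i.isLt)

/-- At a threshold index `j` there is a market-clearing price: it separates the first `j`
utilities from the remaining ones, and the first `j` costs from the remaining ones. -/
theorem exists_clearing_price {K N j : ℕ} (hK : 0 < K) (hN : 0 < N)
    {R : Fin K → ℝ} {C : Fin N → ℝ} (hR : Antitone R) (hC : Monotone C)
    (hjK : j ≤ K) (hjN : j ≤ N)
    (hfeas : ∀ i : Fin j, C (Fin.castLE hjN i) ≤ R (Fin.castLE hjK i))
    (hedge : ∀ (h1 : j < K) (h2 : j < N), R ⟨j, h1⟩ < C ⟨j, h2⟩) :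
    ∃ p : ℝ, (∀ k : Fin K, (k : ℕ) < j → p ≤ R k) ∧ (∀ k : Fin K, j ≤ (k : ℕ) → R k ≤ p) ∧
      (∀ n : Fin N, (n : ℕ) < j → C n ≤ p) ∧ (∀ n : Fin N, j ≤ (n : ℕ) → p ≤ C n) := by
  rcases j with _ | j
  · refine ⟨R ⟨0, hK⟩, by simp, fun k _ ↦ hR (Nat.zero_le k), by simp, fun n _ ↦ ?_⟩
    exact (hedge hK hN).le.trans (hC (Nat.zero_le n))
  have hlast : C ⟨j, hjN⟩ ≤ R ⟨j, hjK⟩ := hfeas (Fin.last j)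
  rcases hjK.lt_or_eq with hlt | rfl
  · refine ⟨max (C ⟨j, hjN⟩) (R ⟨j + 1, hlt⟩), fun k hk ↦ max_le ?_ ?_, fun k hk ↦ ?_,
      fun n hn ↦ ?_, fun n hn ↦ max_le ?_ ?_⟩
    · exact hlast.trans (hR (Nat.le_of_lt_succ hk))
    · exact hR hk.le
    · exact (hR hk).trans (le_max_right _ _)
    · exact (hC (Nat.le_of_lt_succ hn)).trans (le_max_left _ _)
    · exact hC (Nat.le_of_succ_le hn)
    · exact (hedge hlt (hn.trans_lt n.isLt)).le.trans (hC hn)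
  · refine ⟨C ⟨j, hjN⟩, fun k hk ↦ ?_, fun k hk ↦ absurd k.isLt hk.not_gt,
      fun n hn ↦ ?_, fun n hn ↦ ?_⟩
    · exact hlast.trans (hR (Nat.le_of_lt_succ hk))
    · exact hC (Nat.le_of_lt_succ hn)
    · exact hC (Nat.le_of_succ_le hn)


/-- Quantity-weighted surplus upper bound: every feasible partial matching has
quantity-weighted surplus at most `b̄ · ∑_{i<j} (R i − C i)`, where `j` is the
threshold index and all trading quantities lie in `(0, b̄]`. -/
theorem quantity_weighted_surplus_upper_bound
    (K N j : ℕ) (hK : 0 < K) (hN : 0 < N)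
    (R : Fin K → ℝ) (C : Fin N → ℝ)
    (hR : Antitone R) (hC : Monotone C)
    (hj : j ≤ min K N)
    (hfeasj : ∀ i : Fin j,
      C (Fin.castLE (hj.trans (min_le_right K N)) i) ≤
        R (Fin.castLE (hj.trans (min_le_left K N)) i))
    (hedge : j = min K N ∨
      ∀ (h1 : j < K) (h2 : j < N), R ⟨j, h1⟩ < C ⟨j, h2⟩)
    (bbar : ℝ) (b : Fin K → ℝ) (q : Fin N → ℝ)
    (hb : ∀ k, 0 < b k ∧ b k ≤ bbar) (hq : ∀ n, 0 < q n ∧ q n ≤ bbar)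
    (s : ℕ) (hs : s ≤ min K N)
    (ι : Fin s → Fin K) (σ : Fin s → Fin N)
    (hι : Function.Injective ι) (hσ : Function.Injective σ)
    (hfeas : ∀ i : Fin s, C (σ i) ≤ R (ι i)) :
    ∑ i : Fin s, min (b (ι i)) (q (σ i)) * (R (ι i) - C (σ i)) ≤
      bbar * ∑ i : Fin j, (R (Fin.castLE (hj.trans (min_le_left K N)) i)
        - C (Fin.castLE (hj.trans (min_le_right K N)) i)) := by
  have hjK := hj.trans (min_le_left K N)
  have hjN := hj.trans (min_le_right K N)
  obtain ⟨p, hpR, hRp, hCp, hpC⟩ := exists_clearing_price hK hN hR hC hjK hjN hfeasj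
    (hedge.elim (fun h h1 h2 ↦ absurd (lt_min h1 h2) h.not_lt) id)
  have hbuy := Fin.sum_comp_injective_le_sum_castLE hjK (f := fun k ↦ R k - p)
    (fun k hk ↦ sub_nonneg.2 (hpR k hk)) (fun k hk ↦ sub_nonpos.2 (hRp k hk)) hι
  have hsell := Fin.sum_comp_injective_le_sum_castLE hjN (f := fun n ↦ p - C n)
    (fun n hn ↦ sub_nonneg.2 (hCp n hn)) (fun n hn ↦ sub_nonpos.2 (hpC n hn)) hσ
  have hbbar : 0 ≤ bbar := (hb ⟨0, hK⟩).1.le.trans (hb ⟨0, hK⟩).2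
  calc ∑ i : Fin s, min (b (ι i)) (q (σ i)) * (R (ι i) - C (σ i))
      ≤ ∑ i : Fin s, bbar * (R (ι i) - C (σ i)) :=
        Finset.sum_le_sum fun i _ ↦ mul_le_mul_of_nonneg_right
          ((min_le_left _ _).trans (hb _).2) (sub_nonneg.2 (hfeas i))
    _ = bbar * (∑ i, (R (ι i) - p) + ∑ i, (p - C (σ i))) := by
        simp [← Finset.mul_sum]
    _ ≤ bbar * (∑ i, (R (Fin.castLE hjK i) - p) + ∑ i, (p - C (Fin.castLE hjN i))) :=
        mul_le_mul_of_nonneg_left (add_le_add hbuy hsell) hbbar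
    _ = _ := by simp
end

section
/- Let I ≥ 1 and A ≥ 1 be natural numbers and define Φ : ℝ → ℝ by Φ(p) = ∑_{n=0}^{I−1} (I−1 choose n) · p^n · (1−p)^{I−1−n} · ⌈(n+1)/A⌉, where ⌈(n+1)/A⌉ denotes the least integer that is at least (n+1)/A. Then Φ is monotone nondecreasing on [0,1]; moreover, if A ≤ I−1 then Φ is strictly increasing on [0,1]. -/
open Polynomial in
theorem bernsteinPolynomial.derivative_sum_succ {R : Type*} [CommRing R] (m : ℕ) (f : ℕ → R) :
    derivative (∑ n ∈ Finset.range (m + 2), C (f n) * bernsteinPolynomial R (m + 1) n) =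
      (m + 1 : R[X]) *
        ∑ n ∈ Finset.range (m + 1), C (f (n + 1) - f n) * bernsteinPolynomial R m n := by
  have h_shift : ∑ n ∈ Finset.range (m + 1), C (f n) * bernsteinPolynomial R m n =
      ∑ n ∈ Finset.range (m + 1), C (f (n + 1)) * bernsteinPolynomial R m (n + 1) +
        C (f 0) * bernsteinPolynomial R m 0 := by
    rw [← Finset.sum_range_succ' (fun n => C (f n) * bernsteinPolynomial R m n),
      Finset.sum_range_succ _ (m + 1), bernsteinPolynomial.eq_zero_of_lt R (Nat.lt_succ_self m),
      mul_zero, add_zero]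
  have h_succ (n : ℕ) :
      derivative (C (f (n + 1)) * bernsteinPolynomial R (m + 1) (n + 1)) =
        (m + 1 : R[X]) * (C (f (n + 1)) * bernsteinPolynomial R m n) -
          (m + 1 : R[X]) * (C (f (n + 1)) * bernsteinPolynomial R m (n + 1)) := by
    rw [derivative_C_mul, bernsteinPolynomial.derivative_succ]
    push_cast [Nat.add_sub_cancel]
    ring
  rw [Finset.sum_range_succ', derivative_add, derivative_sum]
  simp only [h_succ, C_sub, sub_mul, Finset.sum_sub_distrib, ← Finset.mul_sum, h_shift,
    derivative_C_mul, bernsteinPolynomial.derivative_zero]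
  push_cast [Nat.add_sub_cancel]
  ring

theorem bernsteinPolynomial.eval_eq {R : Type*} [CommRing R] (m n : ℕ) (p : R) :
    (bernsteinPolynomial R m n).eval p = (m.choose n : R) * p ^ n * (1 - p) ^ (m - n) := by
  simp [bernsteinPolynomial]

theorem bernsteinPolynomial.eval_pos {m n : ℕ} (hn : n ≤ m) {p : ℝ} (hp : p ∈ Set.Ioo (0 : ℝ) 1) :
    0 < (bernsteinPolynomial ℝ m n).eval p := by
  have h_choose : (0 : ℝ) < m.choose n := by exact_mod_cast Nat.choose_pos hn
  have h_left := hp.1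
  have h_right : 0 < 1 - p := sub_pos.2 hp.2
  rw [bernsteinPolynomial.eval_eq]
  positivity

theorem bernsteinPolynomial.monotoneOn_eval_sum {f : ℕ → ℝ} (hf : Monotone f) (m : ℕ) :
    MonotoneOn (fun p : ℝ =>
      (∑ n ∈ Finset.range (m + 1), Polynomial.C (f n) * bernsteinPolynomial ℝ m n).eval p)
      (Set.Icc 0 1) := by
  cases m with
  | zero => simp [bernsteinPolynomial, monotoneOn_const]
  | succ m =>
    refine monotoneOn_of_deriv_nonneg (convex_Icc 0 1) (Polynomial.continuousOn _)
      (Polynomial.differentiableOn _) fun p hp => ?_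
    rw [interior_Icc] at hp
    rw [Polynomial.deriv, bernsteinPolynomial.derivative_sum_succ]
    simp only [Polynomial.eval_mul, Polynomial.eval_finsetSum, Polynomial.eval_C,
      Polynomial.eval_add, Polynomial.eval_natCast, Polynomial.eval_one]
    refine mul_nonneg (by positivity) (Finset.sum_nonneg fun n hn => ?_)
    exact mul_nonneg (sub_nonneg.2 (hf n.le_succ))
      (bernsteinPolynomial.eval_pos (Finset.mem_range_succ_iff.1 hn) hp).le

theorem bernsteinPolynomial.strictMonoOn_eval_sum {f : ℕ → ℝ} (hf : Monotone f) {m k : ℕ}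
    (hk : k < m) (hfk : f k < f (k + 1)) :
    StrictMonoOn (fun p : ℝ =>
      (∑ n ∈ Finset.range (m + 1), Polynomial.C (f n) * bernsteinPolynomial ℝ m n).eval p)
      (Set.Icc 0 1) := by
  cases m with
  | zero => simp at hk
  | succ m =>
    refine strictMonoOn_of_deriv_pos (convex_Icc 0 1) (Polynomial.continuousOn _) fun p hp => ?_
    rw [interior_Icc] at hp
    rw [Polynomial.deriv, bernsteinPolynomial.derivative_sum_succ]
    simp only [Polynomial.eval_mul, Polynomial.eval_finsetSum, Polynomial.eval_C,
      Polynomial.eval_add, Polynomial.eval_natCast, Polynomial.eval_one]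
    refine mul_pos (by positivity) (Finset.sum_pos' (fun n hn => ?_)
      ⟨k, Finset.mem_range.2 hk, mul_pos (sub_pos.2 hfk)
        (bernsteinPolynomial.eval_pos (Nat.lt_succ_iff.1 hk) hp)⟩)
    exact mul_nonneg (sub_nonneg.2 (hf n.le_succ))
      (bernsteinPolynomial.eval_pos (Finset.mem_range_succ_iff.1 hn) hp).le


/-- The expected block-inclusion delay index `Φ(p) = E⌈(B+1)/A⌉`, with
`B ~ Binomial(I−1, p)`, is monotone nondecreasing on `[0,1]`, and strictly
increasing there whenever `A ≤ I − 1`. -/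
theorem expected_delay_monotone
    (I A : ℕ) (hI : 1 ≤ I) (hA : 1 ≤ A) :
    MonotoneOn (fun p : ℝ => ∑ n ∈ Finset.range I,
        ((I - 1).choose n : ℝ) * p ^ n * (1 - p) ^ (I - 1 - n)
          * (⌈((n : ℝ) + 1) / (A : ℝ)⌉ : ℝ))
      (Set.Icc (0 : ℝ) 1)
    ∧ (A ≤ I - 1 →
      StrictMonoOn (fun p : ℝ => ∑ n ∈ Finset.range I,
          ((I - 1).choose n : ℝ) * p ^ n * (1 - p) ^ (I - 1 - n)
            * (⌈((n : ℝ) + 1) / (A : ℝ)⌉ : ℝ))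
        (Set.Icc (0 : ℝ) 1)) := by
  obtain ⟨m, rfl⟩ : ∃ m, I = m + 1 := ⟨I - 1, by omega⟩
  have hA_pos : (0 : ℝ) < A := by exact_mod_cast hA
  set f : ℕ → ℝ := fun n => (⌈((n : ℝ) + 1) / (A : ℝ)⌉ : ℝ) with hf_def
  have hf : Monotone f := fun a b hab => by
    simp only [hf_def]
    gcongr
  have h_eq : (fun p : ℝ => ∑ n ∈ Finset.range (m + 1),
      ((m + 1 - 1).choose n : ℝ) * p ^ n * (1 - p) ^ (m + 1 - 1 - n)
        * (⌈((n : ℝ) + 1) / (A : ℝ)⌉ : ℝ)) = fun p : ℝ =>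
      (∑ n ∈ Finset.range (m + 1), Polynomial.C (f n) * bernsteinPolynomial ℝ m n).eval p := by
    funext p
    simp only [Polynomial.eval_finsetSum, Polynomial.eval_mul, Polynomial.eval_C,
      bernsteinPolynomial.eval_eq, Nat.add_sub_cancel, hf_def]
    exact Finset.sum_congr rfl fun n _ => mul_comm _ _
  rw [h_eq]
  refine ⟨bernsteinPolynomial.monotoneOn_eval_sum hf m, fun hAm => ?_⟩
  refine bernsteinPolynomial.strictMonoOn_eval_sum hf (k := A - 1) (by omega) ?_
  have h_one : ⌈(((A - 1 : ℕ) : ℝ) + 1) / (A : ℝ)⌉ = 1 := by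
    rw [Nat.cast_pred hA, sub_add_cancel, div_self hA_pos.ne', Int.ceil_one]
  have h_gt : 1 < ⌈(((A - 1 + 1 : ℕ) : ℝ) + 1) / (A : ℝ)⌉ := by
    rw [Nat.sub_add_cancel hA, Int.lt_ceil, Int.cast_one, one_lt_div hA_pos]
    exact lt_add_one _
  simp only [hf_def, h_one]
  exact_mod_cast h_gt
end

section
/- Let A ≥ 1 and I be natural numbers with I > A, and let d > 0, σ ≥ 0, ε > 0 be real numbers. Then for every real f with σ + ε ≤ f ≤ σ + ε + (⌈I/A⌉ − 1)·d, there exists a unique F ∈ [0,1] such that ∑_{n=0}^{I−1} (I−1 choose n) · (1−F)^n · F^{I−1−n} · (f + ⌈(n+1)/A⌉·d) = σ + ε + ⌈I/A⌉·d, where ⌈x⌉ denotes the least integer that is at least x. (This is the indifference equation defining the mixed-strategy Nash equilibrium CDF in Proposition 2.) -/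
/-- The expectation of `c` under the binomial distribution with parameters `N` and `p`. -/
noncomputable def binomialMean (c : ℕ → ℝ) (N : ℕ) (p : ℝ) : ℝ :=
  ∑ n ∈ Finset.range (N + 1), (N.choose n : ℝ) * (p ^ n * (1 - p) ^ (N - n) * c n)

lemma binomialMean_succ (c : ℕ → ℝ) (N : ℕ) (p : ℝ) :
    binomialMean c (N + 1) p =
      (1 - p) * binomialMean c N p + p * binomialMean (fun n => c (n + 1)) N p := by
  unfold binomialMean
  rw [Finset.sum_choose_succ_mul (fun i j => p ^ i * (1 - p) ^ j * c i), Finset.mul_sum,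
    Finset.mul_sum]
  congr 1
  · refine Finset.sum_congr rfl fun n hn => ?_
    rw [Nat.sub_add_comm (Finset.mem_range_succ_iff.mp hn), pow_succ]
    ring
  · refine Finset.sum_congr rfl fun n _ => ?_
    ring

lemma binomialMean_zero_right (c : ℕ → ℝ) (N : ℕ) : binomialMean c N 0 = c 0 := by
  simp [binomialMean, Finset.sum_range_succ']

lemma binomialMean_one_right (c : ℕ → ℝ) (N : ℕ) : binomialMean c N 1 = c N := by
  induction N generalizing c with
  | zero => simp [binomialMean]
  | succ N ih => simp [binomialMean_succ, ih]

lemma continuous_binomialMean (c : ℕ → ℝ) (N : ℕ) : Continuous (binomialMean c N) := by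
  unfold binomialMean
  fun_prop

lemma pow_mul_sub_le_binomialMean_shift_sub {c : ℕ → ℝ} (hc : Monotone c) (N : ℕ) {p : ℝ}
    (hp : p ∈ Set.Icc (0 : ℝ) 1) :
    (1 - p) ^ N * (c 1 - c 0) ≤
      binomialMean (fun n => c (n + 1)) N p - binomialMean c N p := by
  unfold binomialMean
  rw [← Finset.sum_sub_distrib]
  have hq : 0 ≤ 1 - p := sub_nonneg.mpr hp.2
  have h := Finset.single_le_sum (s := Finset.range (N + 1)) (a := 0)
    (f := fun n => (N.choose n : ℝ) * (p ^ n * (1 - p) ^ (N - n) * c (n + 1)) -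
      (N.choose n : ℝ) * (p ^ n * (1 - p) ^ (N - n) * c n))
    (fun n _ => by
      have hp0 := hp.1
      have hn : 0 ≤ c (n + 1) - c n := sub_nonneg.mpr (hc n.le_succ)
      have : 0 ≤ (N.choose n : ℝ) * (p ^ n * (1 - p) ^ (N - n) * (c (n + 1) - c n)) := by
        positivity
      linarith) (by simp)
  refine le_trans (le_of_eq ?_) h
  simp
  ring

lemma binomialMean_succ_sub (c : ℕ → ℝ) (N : ℕ) (p q : ℝ) :
    binomialMean c (N + 1) q - binomialMean c (N + 1) p =
      (1 - q) * (binomialMean c N q - binomialMean c N p) +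
      q * (binomialMean (fun n => c (n + 1)) N q - binomialMean (fun n => c (n + 1)) N p) +
      (q - p) * (binomialMean (fun n => c (n + 1)) N p - binomialMean c N p) := by
  rw [binomialMean_succ, binomialMean_succ]
  ring

lemma monotoneOn_binomialMean {c : ℕ → ℝ} (hc : Monotone c) (N : ℕ) :
    MonotoneOn (binomialMean c N) (Set.Icc 0 1) := by
  induction N generalizing c with
  | zero => simp [binomialMean, MonotoneOn]
  | succ N ih =>
    intro p hp q hq hpq
    have hc' : Monotone fun n => c (n + 1) := fun _ _ h => hc (Nat.succ_le_succ h)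
    have h₁ := mul_nonneg (sub_nonneg.mpr hq.2) (sub_nonneg.mpr (ih hc hp hq hpq))
    have h₂ := mul_nonneg hq.1 (sub_nonneg.mpr (ih hc' hp hq hpq))
    have h₃ := mul_nonneg (sub_nonneg.mpr hpq) <|
      (mul_nonneg (pow_nonneg (sub_nonneg.mpr hp.2) N) (sub_nonneg.mpr (hc zero_le_one))).trans
        (pow_mul_sub_le_binomialMean_shift_sub hc N hp)
    have := binomialMean_succ_sub c N p q
    linarith

lemma strictMonoOn_binomialMean {c : ℕ → ℝ} (hc : Monotone c) {N : ℕ} (hN : c 0 < c N) :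
    StrictMonoOn (binomialMean c N) (Set.Icc 0 1) := by
  induction N generalizing c with
  | zero => exact absurd hN (lt_irrefl _)
  | succ N ih =>
    intro p hp q hq hpq
    have hc' : Monotone fun n => c (n + 1) := fun _ _ h => hc (Nat.succ_le_succ h)
    have h₁ := mul_nonneg (sub_nonneg.mpr hq.2)
      (sub_nonneg.mpr (monotoneOn_binomialMean hc N hp hq hpq.le))
    have h₂ := mul_nonneg hq.1 (sub_nonneg.mpr (monotoneOn_binomialMean hc' N hp hq hpq.le))
    have h₃ := mul_le_mul_of_nonneg_left (pow_mul_sub_le_binomialMean_shift_sub hc N hp)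
      (sub_nonneg.mpr hpq.le)
    have hsub := binomialMean_succ_sub c N p q
    have hpow : 0 < (q - p) * (1 - p) ^ N :=
      mul_pos (sub_pos.mpr hpq) (pow_pos (sub_pos.mpr (hpq.trans_le hq.2)) N)
    rcases (hc zero_le_one).lt_or_eq with h01 | h01
    · have := mul_pos hpow (sub_pos.mpr h01)
      linarith
    · have := mul_pos (hp.1.trans_lt hpq) (sub_pos.mpr (ih hc' (h01 ▸ hN) hp hq hpq))
      rw [h01, sub_self, mul_zero, mul_zero] at h₃
      linarith


/-- Existence and uniqueness of the mixed-strategy equilibrium CDF value: for every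
fee `f` in the equilibrium support, the indifference equation
`g(1−F, f) = σ + ε + ⌈I/A⌉·d` has a unique solution `F ∈ [0,1]`. -/
theorem indifference_equation_unique_solution
    (I A : ℕ) (hA : 1 ≤ A) (hIA : A < I)
    (d σ ε : ℝ) (hd : 0 < d) (hσ : 0 ≤ σ) (hε : 0 < ε)
    (f : ℝ) (hf_lo : σ + ε ≤ f)
    (hf_hi : f ≤ σ + ε + ((⌈(I : ℝ) / (A : ℝ)⌉ : ℝ) - 1) * d) :
    ∃! F : ℝ, F ∈ Set.Icc (0 : ℝ) 1 ∧
      ∑ n ∈ Finset.range I,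
          ((I - 1).choose n : ℝ) * (1 - F) ^ n * F ^ (I - 1 - n)
            * (f + (⌈((n : ℝ) + 1) / (A : ℝ)⌉ : ℝ) * d)
        = σ + ε + (⌈(I : ℝ) / (A : ℝ)⌉ : ℝ) * d := by
  obtain ⟨N, rfl⟩ : ∃ N, I = N + 1 := ⟨I - 1, by omega⟩
  have hA0 : (0 : ℝ) < A := by exact_mod_cast hA
  have hAN : (A : ℝ) < N + 1 := by exact_mod_cast hIA
  set c : ℕ → ℝ := fun n => f + (⌈((n : ℝ) + 1) / (A : ℝ)⌉ : ℝ) * d with hc_def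
  have hc : Monotone c := fun m n hmn => by
    simp only [hc_def]
    gcongr
  have hceil : ⌈((0 : ℕ) + 1 : ℝ) / (A : ℝ)⌉ = 1 := by
    rw [Int.ceil_eq_iff]
    constructor
    · norm_num
      exact hA
    · rw [div_le_iff₀ hA0]
      norm_num
      exact hA
  have hc0 : c 0 = f + d := by
    simp only [hc_def, hceil]
    norm_num
  have hcN : c 0 < c N := by
    have h : (1 : ℤ) < ⌈((N : ℝ) + 1) / (A : ℝ)⌉ := by
      rw [Int.lt_ceil, Int.cast_one, one_lt_div hA0]
      exact hAN
    simp only [hc_def, hceil]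
    gcongr
  have hsum : ∀ F : ℝ, ∑ n ∈ Finset.range (N + 1),
      ((N + 1 - 1).choose n : ℝ) * (1 - F) ^ n * F ^ (N + 1 - 1 - n)
        * (f + (⌈((n : ℝ) + 1) / (A : ℝ)⌉ : ℝ) * d) =
        binomialMean c N (1 - F) := fun F => by
    simp only [binomialMean, hc_def, sub_sub_cancel, Nat.add_sub_cancel, mul_assoc]
  have hmem : σ + ε + (⌈((N + 1 : ℕ) : ℝ) / (A : ℝ)⌉ : ℝ) * d ∈
      Set.Icc (binomialMean c N 0) (binomialMean c N 1) := by
    rw [binomialMean_zero_right, binomialMean_one_right, hc0]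
    simp only [hc_def]
    push_cast at hf_hi ⊢
    constructor <;> linarith
  obtain ⟨p, hp, hpv⟩ := intermediate_value_Icc zero_le_one
    (continuous_binomialMean c N).continuousOn hmem
  simp only [hsum]
  refine ⟨1 - p, ⟨⟨by linarith [hp.2], by linarith [hp.1]⟩, by rwa [sub_sub_cancel]⟩, ?_⟩
  rintro F ⟨hF, hFv⟩
  have := (strictMonoOn_binomialMean hc hcN).injOn
    ⟨sub_nonneg.mpr hF.2, sub_le_self _ hF.1⟩ hp (hFv.trans hpv.symm)
  linarith
end

section
/- Let I ≥ 1 and A ≥ 1 be natural numbers, d ≥ 0 and x real numbers, and ζ₁, ζ₂ ≥ 0 reals with 0 < ζ₁ + ζ₂ ≤ 1. Then ∑_{n=0}^{I−1} (I−1 choose n)(ζ₁+ζ₂)^n (1−ζ₁−ζ₂)^{I−1−n} ∑_{j=0}^{n} (n choose j)(ζ₂/(ζ₁+ζ₂))^j (ζ₁/(ζ₁+ζ₂))^{n−j} · (x + (d/(j+1)) ∑_{l=1}^{j+1} ⌈(n−j+l)/A⌉) ≥ ∑_{n=0}^{I−1} (I−1 choose n) ζ₁^n (1−ζ₁)^{I−1−n}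 (x + ⌈(n+1)/A⌉·d), where ⌈y⌉ denotes the least integer that is at least y. That is, when each competitor independently pays a strictly higher fee with probability ζ₁ or ties (with uniformly random tie-breaking) with probability ζ₂, the expected fee-plus-delay cost is at least what it would be if all tied competitors were instead counted as paying lower fees. -/
/-- Thinning of a binomial sum: choosing `n` out of `N` and then splitting the chosen ones into two
classes amounts to choosing the first class alone, the other two weights being added. -/
theorem sum_choose_mul_sum_choose_mul {R : Type*} [CommSemiring R] (N : ℕ) (a b c : R)
    (F : ℕ → R) :
    ∑ n ∈ Finset.range (N + 1), (N.choose n : R) * c ^ (N - n)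
        * ∑ j ∈ Finset.range (n + 1), (n.choose j : R) * b ^ j * a ^ (n - j) * F (n - j)
      = ∑ k ∈ Finset.range (N + 1), (N.choose k : R) * a ^ k * (b + c) ^ (N - k) * F k := by
  have hflip (n : ℕ) :
      ∑ j ∈ Finset.range (n + 1), (n.choose j : R) * b ^ j * a ^ (n - j) * F (n - j)
        = ∑ k ∈ Finset.range (n + 1), (n.choose k : R) * b ^ (n - k) * a ^ k * F k := by
    rw [← Finset.sum_flip]
    refine Finset.sum_congr rfl fun k hk => ?_
    have hkn : k ≤ n := Nat.lt_succ_iff.mp (Finset.mem_range.mp hk)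
    rw [Nat.choose_symm hkn, Nat.sub_sub_self hkn]
  simp_rw [hflip, Finset.mul_sum]
  rw [Finset.sum_comm' (t' := Finset.range (N + 1)) (s' := fun k => Finset.Ico k (N + 1))
    (by intro n k; simp only [Finset.mem_range, Finset.mem_Ico]; omega)]
  refine Finset.sum_congr rfl fun k hk => ?_
  have hkN : k ≤ N := Nat.lt_succ_iff.mp (Finset.mem_range.mp hk)
  rw [Finset.sum_Ico_eq_sum_range, add_pow, Finset.mul_sum, Finset.sum_mul,
    Nat.sub_add_comm hkN]
  refine Finset.sum_congr rfl fun m hm => ?_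
  have hm' : k + m ≤ N := by have := Finset.mem_range.mp hm; omega
  have hchoose : (N.choose (k + m) : R) * ((k + m).choose k : R)
      = (N.choose k : R) * ((N - k).choose m : R) := by
    have h := Nat.choose_mul (n := N) (k := k + m) (s := k) (Nat.le_add_right k m)
    rw [Nat.add_sub_cancel_left] at h
    exact_mod_cast congrArg (Nat.cast : ℕ → R) h
  rw [Nat.add_sub_cancel_left, ← Nat.sub_sub]
  calc _ = ((N.choose (k + m) : R) * ((k + m).choose k : R))
        * (c ^ (N - k - m) * b ^ m * a ^ k * F k) := by ring
    _ = _ := by rw [hchoose]; ring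

/-- The average of the delays over the possible positions of a transaction among `j + 1` tied ones
is at least the delay in the first of these positions. -/
theorem first_delay_le_average_delay (A m j : ℕ) {d : ℝ} (hd : 0 ≤ d) :
    (⌈((m : ℝ) + 1) / (A : ℝ)⌉ : ℝ) * d
      ≤ (d / ((j : ℝ) + 1))
          * ∑ l ∈ Finset.Icc 1 (j + 1), (⌈((m + l : ℕ) : ℝ) / (A : ℝ)⌉ : ℝ) := by
  have hsum : ((j : ℝ) + 1) * (⌈((m : ℝ) + 1) / (A : ℝ)⌉ : ℝ)
      ≤ ∑ l ∈ Finset.Icc 1 (j + 1), (⌈((m + l : ℕ) : ℝ) / (A : ℝ)⌉ : ℝ) := by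
    have h := Finset.card_nsmul_le_sum (Finset.Icc 1 (j + 1))
      (fun l => (⌈((m + l : ℕ) : ℝ) / (A : ℝ)⌉ : ℝ)) (⌈((m : ℝ) + 1) / (A : ℝ)⌉ : ℝ) (by
        intro l hl
        have hl' : (1 : ℝ) ≤ l := by exact_mod_cast (Finset.mem_Icc.mp hl).1
        have : ⌈((m : ℝ) + 1) / (A : ℝ)⌉ ≤ ⌈((m + l : ℕ) : ℝ) / (A : ℝ)⌉ := by
          push_cast
          gcongr
        exact_mod_cast this)
    simpa [nsmul_eq_mul] using h
  have hj : (0 : ℝ) < (j : ℝ) + 1 := by positivity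
  calc _ = (d / ((j : ℝ) + 1)) * (((j : ℝ) + 1) * (⌈((m : ℝ) + 1) / (A : ℝ)⌉ : ℝ)) := by
        field_simp
    _ ≤ _ := by gcongr


/-- Tie-breaking inequality: when each of the `I−1` competitors independently pays a
strictly higher fee with probability `ζ₁` or ties (with uniformly random
tie-breaking) with probability `ζ₂`, the expected fee-plus-delay cost is at least
what it would be if all tied competitors were counted as paying lower fees. -/
theorem tie_breaking_delay_inequality
    (I A : ℕ) (hI : 1 ≤ I) (hA : 1 ≤ A)
    (d x : ℝ) (hd : 0 ≤ d)
    (ζ₁ ζ₂ : ℝ) (hζ₁ : 0 ≤ ζ₁) (hζ₂ : 0 ≤ ζ₂)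
    (hsum_pos : 0 < ζ₁ + ζ₂) (hsum_le : ζ₁ + ζ₂ ≤ 1) :
    ∑ n ∈ Finset.range I,
        ((I - 1).choose n : ℝ) * (ζ₁ + ζ₂) ^ n * (1 - ζ₁ - ζ₂) ^ (I - 1 - n)
          * ∑ j ∈ Finset.range (n + 1),
              (n.choose j : ℝ) * (ζ₂ / (ζ₁ + ζ₂)) ^ j * (ζ₁ / (ζ₁ + ζ₂)) ^ (n - j)
                * (x + (d / ((j : ℝ) + 1))
                    * ∑ l ∈ Finset.Icc 1 (j + 1),
                        (⌈((n - j + l : ℕ) : ℝ) / (A : ℝ)⌉ : ℝ))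
      ≥ ∑ n ∈ Finset.range I,
          ((I - 1).choose n : ℝ) * ζ₁ ^ n * (1 - ζ₁) ^ (I - 1 - n)
            * (x + (⌈((n : ℝ) + 1) / (A : ℝ)⌉ : ℝ) * d) := by
  obtain ⟨N, rfl⟩ := Nat.exists_eq_add_of_le' hI
  have hc : 0 ≤ 1 - ζ₁ - ζ₂ := by linarith
  rw [Nat.add_sub_cancel, ge_iff_le]
  have hthin := sum_choose_mul_sum_choose_mul N ζ₁ ζ₂ (1 - ζ₁ - ζ₂)
    (fun k => x + (⌈((k : ℝ) + 1) / (A : ℝ)⌉ : ℝ) * d)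
  rw [show ζ₂ + (1 - ζ₁ - ζ₂) = 1 - ζ₁ by ring] at hthin
  rw [← hthin]
  refine Finset.sum_le_sum fun n _ => ?_
  rw [mul_right_comm _ ((ζ₁ + ζ₂) ^ n), mul_assoc _ ((ζ₁ + ζ₂) ^ n)]
  refine mul_le_mul_of_nonneg_left ?_ (by positivity)
  rw [Finset.mul_sum]
  refine Finset.sum_le_sum fun j hj => ?_
  have hjn : j ≤ n := Nat.lt_succ_iff.mp (Finset.mem_range.mp hj)
  have hweight : (n.choose j : ℝ) * ζ₂ ^ j * ζ₁ ^ (n - j)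
      = (ζ₁ + ζ₂) ^ n
        * ((n.choose j : ℝ) * (ζ₂ / (ζ₁ + ζ₂)) ^ j * (ζ₁ / (ζ₁ + ζ₂)) ^ (n - j)) := by
    have hpow : (ζ₁ + ζ₂) ^ n = (ζ₁ + ζ₂) ^ j * (ζ₁ + ζ₂) ^ (n - j) := by
      rw [← pow_add, Nat.add_sub_cancel' hjn]
    rw [hpow, div_pow, div_pow]
    field_simp
  rw [← mul_assoc, ← hweight]
  have := first_delay_le_average_delay A (n - j) j hd
  gcongr
end
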